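/- arXiv:1804.00178 — 2 statements merged into one kernel-verified Lean document; each statement's English description precedes it below -/
import Mathlib

section
/- Let P^•, Q^• be complete flags in H, let a_•, b_• be strictly increasing sequences as in the context, and let Λ ∈ Σ°_{P^•,a_•} ∩ Σ°_{Q^•,b_•}. Let σ be the permutation of {0,…,r} associated to the flags Λ ∩ P^• and Λ ∩ Q^• in Λ, and let λ_0,…,λ_r be a corresponding adapted basis of Λ. Then for every index i active in a_•, Λ ∩ P^{a_i} = span(λ_i, λ_{i+1}, …, λ_r), and for every index i active in b_•, Λ ∩ Q^{b_i} = span{λ_j : 0 ≤ j ≤ r, σ(j) ≥ i}. -/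
open Module Submodule

section Defs

variable (k : Type*) [Field k] {H : Type*} [AddCommGroup H] [Module k H]

/-- A complete flag in `H`, indexed by codimension: `P 0 = H ⊇ P 1 ⊇ ⋯ ⊇ P d = 0`
with `dim (P i) = d - i`. -/
def IsCompleteFlag (d : ℕ) (P : ℕ → Submodule k H) : Prop :=
  (∀ i ≤ d, Module.finrank k ↥(P i) = d - i) ∧ ∀ i < d, P (i + 1) ≤ P i

/-- `e` is a `(P,Q)`-basis with associated permutation `τ` (0-indexed: the basis vector
`e ℓ` corresponds to `e_{ℓ+1}` of the paper, and `(τ ℓ).val + 1` to `τ(ℓ+1)`):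
`e ℓ ∈ P^ℓ ∖ P^{ℓ+1}` and `e ℓ ∈ Q^{τ ℓ} ∖ Q^{τ ℓ + 1}`. -/
def IsFlagPermBasis (d : ℕ) (P Q : ℕ → Submodule k H)
    (τ : Equiv.Perm (Fin d)) (e : Fin d → H) : Prop :=
  LinearIndependent k e ∧ Submodule.span k (Set.range e) = ⊤ ∧
  (∀ ℓ : Fin d, e ℓ ∈ P ℓ.val ∧ e ℓ ∉ P (ℓ.val + 1)) ∧
  (∀ ℓ : Fin d, e ℓ ∈ Q (τ ℓ).val ∧ e ℓ ∉ Q ((τ ℓ).val + 1))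

/-- Complete flags `P`, `Q` are transverse: `P^i ∩ Q^{d-i} = 0` for `0 < i < d`. -/
def FlagsTransverse (d : ℕ) (P Q : ℕ → Submodule k H) : Prop :=
  ∀ i, 0 < i → i < d → P i ⊓ Q (d - i) = ⊥

/-- Complete flags `P`, `Q` are almost-transverse. -/
def FlagsAlmostTransverse (d : ℕ) (P Q : ℕ → Submodule k H) : Prop :=
  ∃ t, 1 ≤ t ∧ t < d ∧ Module.finrank k ↥(P t ⊓ Q (d - t)) = 1 ∧
    ∀ i, 1 ≤ i → i < d → i ≠ t → Module.finrank k ↥(P i ⊓ Q (d - i)) = 0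

/-- The index `i` is active in the sequence `a`. -/
def ActiveIdx (a : ℕ → ℕ) (i : ℕ) : Prop :=
  (i = 0 ∧ 0 < a 0) ∨ (0 < i ∧ a (i - 1) + 1 < a i)

/-- `Λ` lies in the Schubert variety `Σ_{P,a}` (for `Λ` of dimension `r+1`). -/
def MemSchubert (r : ℕ) (P : ℕ → Submodule k H) (a : ℕ → ℕ) (Λ : Submodule k H) : Prop :=
  ∀ i ≤ r, r + 1 - i ≤ Module.finrank k ↥(Λ ⊓ P (a i))

/-- `Λ` lies in the open subset `Σ°_{P,a}` of the Schubert variety. -/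
def MemSchubertOpen (r : ℕ) (P : ℕ → Submodule k H) (a : ℕ → ℕ) (Λ : Submodule k H) : Prop :=
  MemSchubert k r P a Λ ∧
    ∀ i ≤ r, ActiveIdx a i → Module.finrank k ↥(Λ ⊓ P (a i)) = r + 1 - i

/-- `lam` is an adapted basis of `Λ` for the flags `Λ ∩ P^•` and `Λ ∩ Q^•`, with associated
permutation `σ`: `lam j` lies in the codimension-`j` member of the flag `Λ ∩ P^•` but not in
the codimension-`(j+1)` member (membership in a member of the flag `Λ ∩ P^•` being equivalent
to that member having dimension at least `r + 1 - j`), and likewise for `Λ ∩ Q^•` with `σ j`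
in place of `j`. -/
def IsAdaptedBasis (d r : ℕ) (P Q : ℕ → Submodule k H) (Λ : Submodule k H)
    (σ : Equiv.Perm (Fin (r + 1))) (lam : Fin (r + 1) → H) : Prop :=
  LinearIndependent k lam ∧ Submodule.span k (Set.range lam) = Λ ∧
  (∀ j : Fin (r + 1), ∀ i ≤ d,
    (lam j ∈ Λ ⊓ P i ↔ r + 1 - j.val ≤ Module.finrank k ↥(Λ ⊓ P i))) ∧
  (∀ j : Fin (r + 1), ∀ i ≤ d,
    (lam j ∈ Λ ⊓ Q i ↔ r + 1 - (σ j).val ≤ Module.finrank k ↥(Λ ⊓ Q i)))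

/-- The subspace of `Hom(Λ, H/Λ)` of maps `φ` with `φ(Λ ∩ P^{a i}) ⊆ (P^{a i} + Λ)/Λ`
for all `i ∈ S`. -/
def schubertTangent (P : ℕ → Submodule k H) (a : ℕ → ℕ) (Λ : Submodule k H) (S : Set ℕ) :
    Submodule k (↥Λ →ₗ[k] H ⧸ Λ) :=
  ⨅ i ∈ S, Submodule.compatibleMaps
    (Submodule.comap Λ.subtype (P (a i))) (Submodule.map Λ.mkQ (P (a i)))

/-- The tangent-space model `T(Λ)` at `Λ ∈ Σ°_{P,a} ∩ Σ°_{Q,b}`: all `φ : Λ → H/Λ` with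
`φ(Λ ∩ P^{a i}) ⊆ (P^{a i} + Λ)/Λ` for every `i` active in `a` and
`φ(Λ ∩ Q^{b i}) ⊆ (Q^{b i} + Λ)/Λ` for every `i` active in `b`. -/
def pairTangent (r : ℕ) (P Q : ℕ → Submodule k H) (a b : ℕ → ℕ) (Λ : Submodule k H) :
    Submodule k (↥Λ →ₗ[k] H ⧸ Λ) :=
  schubertTangent k P a Λ {i | i ≤ r ∧ ActiveIdx a i} ⊓
    schubertTangent k Q b Λ {i | i ≤ r ∧ ActiveIdx b i}

/-- The number of inversions of a permutation of `Fin d`. -/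
def invCount {d : ℕ} (τ : Equiv.Perm (Fin d)) : ℕ :=
  ((Finset.univ : Finset (Fin d × Fin d)).filter fun p => p.1 < p.2 ∧ τ p.2 < τ p.1).card

end Defs

/-- A strictly increasing finite sequence is bounded by its last term. -/
theorem le_last_of_strictMono_on {r : ℕ} {a : ℕ → ℕ} (ha : ∀ i < r, a i < a (i + 1))
    {i : ℕ} (hi : i ≤ r) : a i ≤ a r := by
  induction r, hi using Nat.le_induction with
  | base => exact le_rfl
  | succ n _ ih => exact (ih fun j hj => ha j (by omega)).trans (ha n (by omega)).le

theorem card_perm_ge {n : ℕ} (τ : Equiv.Perm (Fin n)) (i : Fin n) :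
    Fintype.card {j : Fin n // i ≤ τ j} = n - i := by
  rw [Fintype.card_congr (τ.subtypeEquiv fun _ => Iff.rfl : {j // i ≤ τ j} ≃ {j // i ≤ j}),
    Fintype.card_subtype, ← Fin.card_Ici]
  congr 1
  ext j
  simp

/-- If a subspace `W` of dimension `n - i` contains exactly those vectors `lam j` of a linearly
independent family for which `n - τ j ≤ dim W`, then those vectors span it. -/
theorem eq_span_of_mem_iff_finrank {k H : Type*} [Field k] [AddCommGroup H] [Module k H]
    {n : ℕ} {lam : Fin n → H} (hli : LinearIndependent k lam)
    (τ : Equiv.Perm (Fin n)) {W : Submodule k H} [FiniteDimensional k W]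
    (hmem : ∀ j, lam j ∈ W ↔ n - (τ j).val ≤ Module.finrank k W)
    {i : ℕ} (hi : i < n) (hW : Module.finrank k W = n - i) :
    W = Submodule.span k {x | ∃ j : Fin n, i ≤ (τ j).val ∧ x = lam j} := by
  have hset : {x | ∃ j : Fin n, i ≤ (τ j).val ∧ x = lam j} =
      Set.range (lam ∘ Subtype.val (p := fun j => (⟨i, hi⟩ : Fin n) ≤ τ j)) := by
    ext x
    simp [Fin.le_def, eq_comm]
  symm
  apply Submodule.eq_of_le_of_finrank_eq
  · rw [Submodule.span_le]
    rintro _ ⟨j, hj, rfl⟩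
    exact (hmem j).2 (by omega)
  · rw [hset, finrank_span_eq_card (hli.comp _ Subtype.val_injective), card_perm_ge, hW]

/-- for `Λ ∈ Σ°_{P,a} ∩ Σ°_{Q,b}` with adapted basis `λ_0, …, λ_r` and
associated permutation `σ`, for every `i` active in `a` one has
`Λ ∩ P^{a i} = span (λ_i, …, λ_r)`, and for every `i` active in `b` one has
`Λ ∩ Q^{b i} = span {λ_j : σ(j) ≥ i}`. -/
theorem adaptedBasis_spans (k H : Type*) [Field k] [IsAlgClosed k]
    [AddCommGroup H] [Module k H] (d : ℕ) (hd : 1 ≤ d)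
    (hH : Module.finrank k H = d) (P Q : ℕ → Submodule k H)
    (hP : IsCompleteFlag k d P) (hQ : IsCompleteFlag k d Q)
    (r : ℕ) (a b : ℕ → ℕ)
    (ha : ∀ i < r, a i < a (i + 1)) (had : a r < d)
    (hb : ∀ i < r, b i < b (i + 1)) (hbd : b r < d)
    (Λ : Submodule k H) (hΛ : Module.finrank k ↥Λ = r + 1)
    (hΛa : MemSchubertOpen k r P a Λ) (hΛb : MemSchubertOpen k r Q b Λ)
    (σ : Equiv.Perm (Fin (r + 1))) (lam : Fin (r + 1) → H)
    (hadapt : IsAdaptedBasis k d r P Q Λ σ lam) :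
    (∀ i ≤ r, ActiveIdx a i →
      Λ ⊓ P (a i) =
        Submodule.span k {x | ∃ j : Fin (r + 1), i ≤ j.val ∧ x = lam j}) ∧
    (∀ i ≤ r, ActiveIdx b i →
      Λ ⊓ Q (b i) =
        Submodule.span k {x | ∃ j : Fin (r + 1), i ≤ (σ j).val ∧ x = lam j}) := by
  obtain ⟨hli, -, hp, hq⟩ := hadapt
  have : FiniteDimensional k Λ := FiniteDimensional.of_finrank_pos (by omega)
  refine ⟨fun i hi hact => ?_, fun i hi hact => ?_⟩
  · have hle := le_last_of_strictMono_on ha hi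
    exact eq_span_of_mem_iff_finrank hli (Equiv.refl _) (fun j => hp j (a i) (by omega))
      (by omega) (hΛa.2 i hi hact)
  · have hle := le_last_of_strictMono_on hb hi
    exact eq_span_of_mem_iff_finrank hli σ (fun j => hq j (b i) (by omega))
      (by omega) (hΛb.2 i hi hact)
end

section
/- Let P^• be a complete flag in H, let a_• be a strictly increasing sequence as in the context, let Λ ⊆ H be a subspace of dimension r + 1, and let S ⊆ {0,…,r} be a set of indices such that dim_k(Λ ∩ P^{a_i}) = r + 1 − i for all i ∈ S. For i ∈ S, let i_n denote the least element of S greater than i, or i_n := r + 1 if i is the largest element of S. Then the linear subspace {φ ∈ Hom_k(Λ, H/Λ) : φ(Λ ∩ P^{a_i}) ⊆ (P^{a_i} + Λ)/Λ for all i ∈ S} of Hom_k(Λ, H/Λ) has dimension (r+1)(d−r−1) − Σ_{i∈S} (i_n − i)(a_i − i). -/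
open Module Submodule

section LinearAlgebra

variable {k V W : Type*} [Field k] [AddCommGroup V] [Module k V] [AddCommGroup W] [Module k W]

/-- Restriction to `A` followed by reduction modulo `B`. -/
def restrictMkQ (A : Submodule k V) (B : Submodule k W) : (V →ₗ[k] W) →ₗ[k] (A →ₗ[k] W ⧸ B) :=
  LinearMap.lcomp k (W ⧸ B) A.subtype ∘ₗ LinearMap.compRight k B.mkQ

theorem restrictMkQ_apply (A : Submodule k V) (B : Submodule k W) (φ : V →ₗ[k] W) (x : A) :
    restrictMkQ A B φ x = B.mkQ (φ x) := rfl

theorem ker_restrictMkQ (A : Submodule k V) (B : Submodule k W) :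
    LinearMap.ker (restrictMkQ A B) = compatibleMaps A B := by
  ext φ
  rw [LinearMap.mem_ker]
  constructor
  · intro h x hx
    have := LinearMap.congr_fun h ⟨x, hx⟩
    rwa [restrictMkQ_apply, LinearMap.zero_apply, mkQ_apply, Quotient.mk_eq_zero] at this
  · intro h
    ext x
    rw [restrictMkQ_apply, LinearMap.zero_apply, mkQ_apply, Quotient.mk_eq_zero]
    exact h x.2

theorem exists_lift_vanishing (A₀ A : Submodule k V) (B : Submodule k W)
    (f : (A ⧸ A₀.comap A.subtype) →ₗ[k] W ⧸ B) :
    ∃ φ : V →ₗ[k] W, (∀ x ∈ A₀, φ x = 0) ∧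
      restrictMkQ A B φ = f ∘ₗ (A₀.comap A.subtype).mkQ := by
  obtain ⟨s, hs⟩ := B.mkQ.exists_rightInverse_of_surjective B.range_mkQ
  let ι : (A ⧸ A₀.comap A.subtype) →ₗ[k] V ⧸ A₀ := mapQ _ A₀ A.subtype le_rfl
  have hι : LinearMap.ker ι = ⊥ := by
    rw [ker_mapQ, eq_bot_iff, map_le_iff_le_comap, comap_bot, ker_mkQ]
  obtain ⟨t, ht⟩ := ι.exists_leftInverse_of_injective hι
  refine ⟨s ∘ₗ f ∘ₗ t ∘ₗ A₀.mkQ, fun x hx => ?_, ?_⟩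
  · have : A₀.mkQ x = 0 := by simpa using hx
    simp only [LinearMap.comp_apply, this, map_zero]
  · ext x
    have h1 : t (A₀.mkQ x) = (A₀.comap A.subtype).mkQ x :=
      LinearMap.congr_fun ht ((A₀.comap A.subtype).mkQ x)
    rw [restrictMkQ_apply]
    simp only [LinearMap.comp_apply, h1]
    exact LinearMap.congr_fun hs _

theorem map_restrictMkQ (T : Submodule k (V →ₗ[k] W)) (A₀ A : Submodule k V)
    (B : Submodule k W) (h₁ : T ≤ compatibleMaps A₀ B)
    (h₂ : ∀ φ : V →ₗ[k] W, (∀ x ∈ A₀, φ x = 0) → φ ∈ T) :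
    T.map (restrictMkQ A B) =
      LinearMap.range (LinearMap.lcomp k (W ⧸ B) (A₀.comap A.subtype).mkQ) := by
  ext ψ
  constructor
  · rintro ⟨φ, hφ, rfl⟩
    refine ⟨liftQ _ (restrictMkQ A B φ) fun x hx => ?_, LinearMap.ext fun _ => rfl⟩
    rw [LinearMap.mem_ker, restrictMkQ_apply, mkQ_apply, Quotient.mk_eq_zero]
    exact h₁ hφ hx
  · rintro ⟨f, rfl⟩
    obtain ⟨φ, hφ, hf⟩ := exists_lift_vanishing A₀ A B f
    exact ⟨φ, h₂ φ hφ, hf⟩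

theorem finrank_inf_compatibleMaps [FiniteDimensional k V] [FiniteDimensional k W]
    (T : Submodule k (V →ₗ[k] W)) (A₀ A : Submodule k V) (hA : A₀ ≤ A)
    (B : Submodule k W) (h₁ : T ≤ compatibleMaps A₀ B)
    (h₂ : ∀ φ : V →ₗ[k] W, (∀ x ∈ A₀, φ x = 0) → φ ∈ T) :
    (finrank k ↥(T ⊓ compatibleMaps A B) : ℤ) =
      finrank k T - ((finrank k A : ℤ) - finrank k A₀) * ((finrank k W : ℤ) - finrank k B) := by
  have hrn := LinearMap.finrank_range_add_finrank_ker ((restrictMkQ A B).domRestrict T)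
  have hker : finrank k (LinearMap.ker ((restrictMkQ A B).domRestrict T)) =
      finrank k ↥(T ⊓ compatibleMaps A B) := by
    rw [LinearMap.ker_domRestrict, ker_restrictMkQ, ← finrank_map_subtype_eq T,
      map_comap_subtype]
  have hinj : Function.Injective (LinearMap.lcomp k (W ⧸ B) (A₀.comap A.subtype).mkQ) := by
    intro f g hfg
    exact linearMap_qext _ hfg
  have hcomap : finrank k (A₀.comap A.subtype) = finrank k A₀ := by
    rw [← finrank_map_subtype_eq A, map_comap_subtype, inf_eq_right.mpr hA]
  rw [LinearMap.range_domRestrict, map_restrictMkQ T A₀ A B h₁ h₂,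
    LinearMap.finrank_range_of_inj hinj, finrank_linearMap, hker] at hrn
  have hq₁ := finrank_quotient_add_finrank (A₀.comap A.subtype)
  have hq₂ := finrank_quotient_add_finrank B
  rw [hcomap] at hq₁
  rw [← hrn, ← hq₁, ← hq₂]
  push_cast
  ring

theorem finrank_comap_subtype_eq_inf (L Q : Submodule k V) :
    finrank k (Q.comap L.subtype) = finrank k ↥(L ⊓ Q) := by
  rw [← finrank_map_subtype_eq L, map_comap_subtype]

theorem finrank_map_mkQ_add_finrank_inf [FiniteDimensional k V] (L Q : Submodule k V) :
    finrank k (Q.map L.mkQ) + finrank k ↥(L ⊓ Q) = finrank k Q := by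
  have h := LinearMap.finrank_range_add_finrank_ker (L.mkQ.domRestrict Q)
  rw [LinearMap.range_domRestrict, LinearMap.ker_domRestrict, ker_mkQ,
    finrank_comap_subtype_eq_inf, inf_comm] at h
  exact h

end LinearAlgebra

theorem IsCompleteFlag.le_of_le {k H : Type*} [Field k] [AddCommGroup H] [Module k H] {d : ℕ}
    {P : ℕ → Submodule k H} (hP : IsCompleteFlag k d P) {i j : ℕ} (hij : i ≤ j) (hj : j ≤ d) :
    P j ≤ P i := by
  induction j, hij using Nat.le_induction with
  | base => exact le_rfl
  | succ n _ ih => exact (hP.2 n hj).trans (ih (by omega))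

theorem lt_of_lt_of_step_lt {r : ℕ} {a : ℕ → ℕ} (ha : ∀ i < r, a i < a (i + 1)) {i j : ℕ}
    (hij : i < j) (hj : j ≤ r) : a i < a j := by
  induction j, hij using Nat.le_induction with
  | base => exact ha i hj
  | succ n _ ih => exact (ih (by omega)).trans (ha n hj)

theorem schubertTangent_insert {k H : Type*} [Field k] [AddCommGroup H] [Module k H]
    (P : ℕ → Submodule k H) (a : ℕ → ℕ) (Λ : Submodule k H) (m : ℕ) (S : Set ℕ) :
    schubertTangent k P a Λ (insert m S) = schubertTangent k P a Λ S ⊓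
      compatibleMaps (comap Λ.subtype (P (a m))) (map Λ.mkQ (P (a m))) := by
  rw [schubertTangent, iInf_insert, inf_comm, schubertTangent]

theorem mem_schubertTangent {k H : Type*} [Field k] [AddCommGroup H] [Module k H]
    {P : ℕ → Submodule k H} {a : ℕ → ℕ} {Λ : Submodule k H} {S : Set ℕ} {φ : Λ →ₗ[k] H ⧸ Λ} :
    φ ∈ schubertTangent k P a Λ S ↔ ∀ i ∈ S, φ ∈
      compatibleMaps (comap Λ.subtype (P (a i))) (map Λ.mkQ (P (a i))) := by
  simp only [schubertTangent, mem_iInf]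

/-- dimension of the space of `φ : Λ → H/Λ` with
`φ(Λ ∩ P^{a i}) ⊆ (P^{a i} + Λ)/Λ` for `i ∈ S`, where
`dim (Λ ∩ P^{a i}) = r + 1 - i` for `i ∈ S`: it equals
`(r+1)(d-r-1) - Σ_{i ∈ S} (i_n - i)(a_i - i)`, where `i_n` is the next element of `S`
after `i` (or `r+1` if there is none). -/
theorem schubertTangent_dim (k H : Type*) [Field k] [IsAlgClosed k]
    [AddCommGroup H] [Module k H] (d : ℕ) (hd : 1 ≤ d)
    (hH : Module.finrank k H = d) (P : ℕ → Submodule k H)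
    (hP : IsCompleteFlag k d P)
    (r : ℕ) (a : ℕ → ℕ) (ha : ∀ i < r, a i < a (i + 1)) (had : a r < d)
    (Λ : Submodule k H) (hΛ : Module.finrank k ↥Λ = r + 1)
    (S : Finset ℕ) (hSr : ∀ i ∈ S, i ≤ r)
    (hSdim : ∀ i ∈ S, Module.finrank k ↥(Λ ⊓ P (a i)) = r + 1 - i) :
    (Module.finrank k ↥(schubertTangent k P a Λ ↑S) : ℤ) =
      ((r : ℤ) + 1) * ((d : ℤ) - (r : ℤ) - 1) -
        ∑ i ∈ S,
          (((sInf (({j | j ∈ S ∧ i < j} ∪ {r + 1} : Set ℕ)) : ℕ) : ℤ) - (i : ℤ)) *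
            ((a i : ℤ) - (i : ℤ)) := by
  have hfin : FiniteDimensional k H := FiniteDimensional.of_finrank_pos (by omega)
  have hquot : finrank k (H ⧸ Λ) + (r + 1) = d := by
    rw [← hΛ, ← hH]
    exact finrank_quotient_add_finrank Λ
  induction S using Finset.induction_on_min with
  | empty =>
    have htop : schubertTangent k P a Λ ↑(∅ : Finset ℕ) = ⊤ := by simp [schubertTangent]
    rw [htop, finrank_top, finrank_linearMap, hΛ, ← hquot]
    push_cast
    rw [Finset.sum_empty]
    ring
  | insert m S hm ih =>
    have hmS : m ∉ S := fun h => (hm m h).false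
    have hmr : m ≤ r := hSr m (Finset.mem_insert_self _ _)
    have had' : ∀ i ≤ r, a i < d := fun i hi => by
      rcases hi.lt_or_eq with h | rfl
      · exact (lt_of_lt_of_step_lt ha h le_rfl).trans had
      · exact had
    have hPle : ∀ i j, i < j → j ≤ r → P (a j) ≤ P (a i) := fun i j hij hj =>
      hP.le_of_le (lt_of_lt_of_step_lt ha hij hj).le (had' j hj).le
    have hSr' : ∀ i ∈ S, i ≤ r := fun i hi => hSr i (Finset.mem_insert_of_mem hi)
    have hnext : {j | j ∈ insert m S ∧ m < j} ∪ {r + 1} = (↑S ∪ {r + 1} : Set ℕ) := by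
      ext j
      simp only [Set.mem_union, Set.mem_ofPred_eq, Finset.mem_insert, Finset.mem_coe]
      have := hm j
      grind
    have hrest : ∀ i ∈ S, ({j | j ∈ insert m S ∧ i < j} ∪ {r + 1} : Set ℕ) =
        {j | j ∈ S ∧ i < j} ∪ {r + 1} := fun i hi => by
      ext j
      simp only [Set.mem_union, Set.mem_ofPred_eq, Finset.mem_insert]
      have := hm i hi
      grind
    have hsum : ∑ i ∈ S, (((sInf ({j | j ∈ insert m S ∧ i < j} ∪ {r + 1} : Set ℕ) : ℕ) : ℤ) - i) *
          ((a i : ℤ) - i) =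
        ∑ i ∈ S, (((sInf ({j | j ∈ S ∧ i < j} ∪ {r + 1} : Set ℕ) : ℕ) : ℤ) - i) *
          ((a i : ℤ) - i) :=
      Finset.sum_congr rfl fun i hi => by rw [hrest i hi]
    obtain ⟨A₀, hA₀, hdim, h₁, h₂⟩ : ∃ A₀ : Submodule k Λ, A₀ ≤ comap Λ.subtype (P (a m)) ∧
        (finrank k A₀ : ℤ) = r + 1 - (sInf (↑S ∪ {r + 1} : Set ℕ) : ℕ) ∧
        schubertTangent k P a Λ S ≤ compatibleMaps A₀ (map Λ.mkQ (P (a m))) ∧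
        ∀ φ : Λ →ₗ[k] H ⧸ Λ, (∀ x ∈ A₀, φ x = 0) → φ ∈ schubertTangent k P a Λ S := by
      rcases S.eq_empty_or_nonempty with rfl | hne
      · refine ⟨⊥, bot_le, by simp, fun φ _ x hx => ?_, fun φ _ => by simp [schubertTangent]⟩
        rw [(mem_bot k).mp hx]
        exact zero_mem _
      · have hn := S.min'_mem hne
        have hleast : IsLeast (↑S ∪ {r + 1} : Set ℕ) (S.min' hne) := by
          refine ⟨Or.inl hn, ?_⟩
          rintro j (hj | rfl)
          · exact S.min'_le j hj
          · exact (hSr' _ hn).trans (Nat.le_succ r)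
        have hmn := hPle m _ (hm _ hn) (hSr' _ hn)
        refine ⟨comap Λ.subtype (P (a (S.min' hne))), comap_mono hmn, ?_,
          fun φ hφ x hx => map_mono hmn (mem_schubertTangent.mp hφ _ hn hx), fun φ hφ => ?_⟩
        · rw [finrank_comap_subtype_eq_inf, hSdim _ (Finset.mem_insert_of_mem hn),
            hleast.csInf_eq]
          have := hSr' _ hn
          omega
        · refine mem_schubertTangent.mpr fun i hi x hx => ?_
          have hle : P (a i) ≤ P (a (S.min' hne)) := by
            rcases (S.min'_le i hi).lt_or_eq with h | h
            · exact hPle _ _ h (hSr' i hi)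
            · rw [h]
          rw [mem_comap, hφ x (hle hx)]
          exact zero_mem _
    have hB := finrank_map_mkQ_add_finrank_inf Λ (P (a m))
    have hAm := hSdim m (Finset.mem_insert_self _ _)
    rw [hAm, hP.1 _ (had' m hmr).le] at hB
    have hlt := had' m hmr
    rw [Finset.coe_insert, schubertTangent_insert,
      finrank_inf_compatibleMaps _ A₀ _ hA₀ _ h₁ h₂, Finset.sum_insert hmS, hnext,
      finrank_comap_subtype_eq_inf, hAm, hdim,
      ih hSr' fun i hi => hSdim i (Finset.mem_insert_of_mem hi), hsum]
    have e₁ : ((r + 1 - m : ℕ) : ℤ) = r + 1 - m := by omega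
    have e₂ : (finrank k (H ⧸ Λ) : ℤ) - finrank k (map Λ.mkQ (P (a m))) = a m - m := by omega
    rw [e₁, e₂]
    ring
end
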